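/- (Lemma A.2.) Let F : E → ℝ be differentiable and L-smooth with L > 0, let x̂ ∈ E be a global minimizer of F, and let σ > 0, δ > 0 be such that the local error bound holds: ‖x − x̂‖ ≤ σ·‖∇F(x)‖ for every x ∈ B(x̂, δ). Set μ = 1/(2Lσ²) and assume L·σ ≥ 1 (so that μ ≤ L/2 < L). Let δ₀ = min{δ, (μ/√(2(L − μ)L))·δ}. If x₀ ∈ B(x̂, δ₀), then every gradient-descent iterate x_k (k ∈ ℕ) with step size 1/L remains in B(x̂, δ). -/

import Mathlib

open Metric

theorem descent_aux {n : ℕ} {F : EuclideanSpace ℝ (Fin n) → ℝ}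
    (hF : Differentiable ℝ F) {L : ℝ}
    (hsmooth : ∀ x₁ x₂, ‖gradient F x₁ - gradient F x₂‖ ≤ L * ‖x₁ - x₂‖)
    (x d : EuclideanSpace ℝ (Fin n)) :
    F (x + d) ≤ F x + inner ℝ (gradient F x) d + L / 2 * ‖d‖ ^ 2 := by
  have hder : ∀ t : ℝ, HasDerivAt
      (fun t : ℝ => F (x + t • d) - t * inner ℝ (gradient F x) d - L / 2 * t ^ 2 * ‖d‖ ^ 2)
      (inner ℝ (gradient F (x + t • d)) d - inner ℝ (gradient F x) d - L * t * ‖d‖ ^ 2) t := by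
    intro t
    have h1 : HasDerivAt (fun t : ℝ => x + t • d) d t := by
      simpa using ((hasDerivAt_id t).smul_const d).const_add x
    have h2 := ((hF (x + t • d)).hasGradientAt).hasFDerivAt.comp_hasDerivAt t h1
    have h3 : HasDerivAt (fun t : ℝ => t * inner ℝ (gradient F x) d)
        (inner ℝ (gradient F x) d) t := by
      simpa using (hasDerivAt_id t).mul_const (inner ℝ (gradient F x) d)
    have h4 : HasDerivAt (fun t : ℝ => L / 2 * t ^ 2 * ‖d‖ ^ 2) (L * t * ‖d‖ ^ 2) t := by
      have h6 := ((hasDerivAt_pow 2 t).const_mul (L / 2)).mul_const (‖d‖ ^ 2)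
      refine h6.congr_deriv ?_
      push_cast
      ring
    have h5 := (h2.sub h3).sub h4
    refine HasDerivAt.congr_deriv (f := fun t : ℝ =>
      F (x + t • d) - t * inner ℝ (gradient F x) d - L / 2 * t ^ 2 * ‖d‖ ^ 2) h5 ?_
    simp
  have hanti : AntitoneOn
      (fun t : ℝ => F (x + t • d) - t * inner ℝ (gradient F x) d - L / 2 * t ^ 2 * ‖d‖ ^ 2)
      (Set.Icc 0 1) := by
    apply antitoneOn_of_deriv_nonpos (convex_Icc 0 1)
    · exact fun t _ => (hder t).continuousAt.continuousWithinAt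
    · exact fun t _ => (hder t).differentiableAt.differentiableWithinAt
    · intro t ht
      rw [interior_Icc] at ht
      rw [(hder t).deriv, ← inner_sub_left]
      have h1 := real_inner_le_norm (gradient F (x + t • d) - gradient F x) d
      have h2 := hsmooth (x + t • d) x
      have h3 : ‖x + t • d - x‖ = t * ‖d‖ := by
        rw [add_sub_cancel_left, norm_smul, Real.norm_of_nonneg ht.1.le]
      rw [h3] at h2
      nlinarith [mul_le_mul_of_nonneg_right h2 (norm_nonneg d)]
  have := hanti (Set.left_mem_Icc.2 zero_le_one) (Set.right_mem_Icc.2 zero_le_one) zero_le_one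
  simp at this ⊢
  linarith

/-- Lemma A.2: if the gradient-descent iteration is started in the small ball
`B(x̂, δ₀)` with `δ₀ = min {δ, (μ/√(2(L−μ)L))·δ}` and `μ = 1/(2Lσ²)`, then
every iterate remains in `B(x̂, δ)`. -/
theorem iterates_stay_in_ball
    (n : ℕ) (F : EuclideanSpace ℝ (Fin n) → ℝ)
    (hF : Differentiable ℝ F)
    (L : ℝ) (hL : 0 < L)
    (hsmooth : ∀ x₁ x₂, ‖gradient F x₁ - gradient F x₂‖ ≤ L * ‖x₁ - x₂‖)
    (xhat : EuclideanSpace ℝ (Fin n))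
    (hmin : ∀ x, F xhat ≤ F x)
    (σ δ : ℝ) (hσ : 0 < σ) (hδ : 0 < δ)
    (herr : ∀ x ∈ closedBall xhat δ, ‖x - xhat‖ ≤ σ * ‖gradient F x‖)
    (μ : ℝ) (hμ : μ = 1 / (2 * L * σ ^ 2))
    (hLσ : 1 ≤ L * σ)
    (δ₀ : ℝ) (hδ₀ : δ₀ = min δ (μ / Real.sqrt (2 * (L - μ) * L) * δ))
    (x : ℕ → EuclideanSpace ℝ (Fin n))
    (hiter : ∀ j : ℕ, x (j + 1) = x j - (1 / L) • gradient F (x j))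
    (hx0 : x 0 ∈ closedBall xhat δ₀) :
    ∀ k : ℕ, x k ∈ closedBall xhat δ := by
  have hs0 : 0 < L * σ := by positivity
  have hg0 : gradient F xhat = 0 := by
    have : fderiv ℝ F xhat = 0 :=
      IsLocalMin.fderiv_eq_zero (Filter.Eventually.of_forall hmin)
    simp [gradient, this]
  have hgr : ∀ y, ‖gradient F y‖ ≤ L * ‖y - xhat‖ := fun y => by
    simpa [hg0] using hsmooth y xhat
  have hup : ∀ y, F y - F xhat ≤ L / 2 * ‖y - xhat‖ ^ 2 := fun y => by
    have := descent_aux hF hsmooth xhat (y - xhat)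
    simp [hg0] at this
    linarith
  have hdesc : ∀ y, F (y - (1 / L) • gradient F y) ≤ F y - 1 / (2 * L) * ‖gradient F y‖ ^ 2 := by
    intro y
    have := descent_aux hF hsmooth y (-((1 / L) • gradient F y))
    rw [← sub_eq_add_neg, inner_neg_right, inner_smul_right, real_inner_self_eq_norm_sq,
      norm_neg, norm_smul, Real.norm_of_nonneg (by positivity)] at this
    refine this.trans (le_of_eq ?_)
    field_simp
    ring
  rw [mem_closedBall, dist_eq_norm] at hx0
  have hr0δ : ‖x 0 - xhat‖ ≤ δ := hx0.trans (hδ₀ ▸ min_le_left _ _)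
  have hμL : μ * (2 * (L * σ) ^ 2) = L := by rw [hμ]; field_simp
  have hμ0 : 0 < μ := by rw [hμ]; positivity
  have hs2 : 1 ≤ (L * σ) ^ 2 := one_le_pow₀ hLσ
  have hμ2 : 2 * μ ≤ L := by nlinarith
  have hsq : L ≤ Real.sqrt (2 * (L - μ) * L) := by
    apply Real.le_sqrt_of_sq_le
    nlinarith
  have hc : μ / Real.sqrt (2 * (L - μ) * L) ≤ 1 / (2 * (L * σ)) := by
    rw [div_le_div_iff₀ (hL.trans_le hsq) (by positivity)]
    nlinarith [mul_le_mul_of_nonneg_left hLσ (by positivity : 0 ≤ μ * (2 * (L * σ)))]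
  have hr0 : 2 * (L * σ) * ‖x 0 - xhat‖ ≤ δ := by
    have h1 : ‖x 0 - xhat‖ ≤ 1 / (2 * (L * σ)) * δ :=
      (hx0.trans (hδ₀ ▸ min_le_right _ _)).trans (mul_le_mul_of_nonneg_right hc hδ.le)
    calc _ ≤ 2 * (L * σ) * (1 / (2 * (L * σ)) * δ) := by gcongr
      _ = δ := by field_simp
  have main : ∀ k, ‖x k - xhat‖ ≤ δ ∧ F (x k) ≤ F (x 0) := by
    intro k
    induction k with
    | zero => exact ⟨hr0δ, le_rfl⟩
    | succ k ih =>
      obtain ⟨hb, hf⟩ := ih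
      have hd := hdesc (x k)
      rw [← hiter] at hd
      have hg2 : 0 ≤ 1 / (2 * L) * ‖gradient F (x k)‖ ^ 2 := by positivity
      refine ⟨?_, by linarith⟩
      have he := herr (x k) (by rwa [mem_closedBall, dist_eq_norm])
      have hgb : 1 / (2 * L) * ‖gradient F (x k)‖ ^ 2 ≤ L / 2 * ‖x 0 - xhat‖ ^ 2 := by
        linarith [hmin (x (k + 1)), hup (x 0)]
      have hgb2 : ‖gradient F (x k)‖ ≤ L * ‖x 0 - xhat‖ := by
        refine abs_le_of_sq_le_sq' ?_ (by positivity) |>.2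
        have := mul_le_mul_of_nonneg_left hgb (by positivity : 0 ≤ 2 * L)
        field_simp at this
        nlinarith
      have hrk : ‖x k - xhat‖ ≤ L * σ * ‖x 0 - xhat‖ := by
        nlinarith [mul_le_mul_of_nonneg_left hgb2 hσ.le]
      have hst : ‖(1 / L) • gradient F (x k)‖ ≤ ‖x k - xhat‖ := by
        rw [norm_smul, Real.norm_of_nonneg (by positivity), one_div, inv_mul_le_iff₀ hL]
        exact hgr _
      have := norm_sub_le (x k - xhat) ((1 / L) • gradient F (x k))
      rw [hiter, sub_right_comm]
      linarith
  intro k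
  rw [mem_closedBall, dist_eq_norm]
  exact (main k).1
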